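/- arXiv:math/0209047 — 2 statements merged into one kernel-verified Lean document; each statement's English description precedes it below -/
import Mathlib

section
/- (Correctness of the algorithm / strong duality for the transportation problem.) Let m, n be positive integers, let a : Fin m → ℝ and b : Fin n → ℝ be nonnegative with ∑ᵢ aᵢ = ∑ⱼ bⱼ, and let c : Fin m → Fin n → ℝ. Then there exist a feasible solution f : Fin m → Fin n → ℝ and vectors α : Fin m → ℝ, β : Fin n → ℝ such that αᵢ − βⱼ ≥ cᵢⱼ for all i, j and fᵢⱼ · (αᵢ − βⱼ − cᵢⱼ) = 0 for all i, j. Consequently f is an optimal solution and ∑ᵢ∑ⱼ cᵢⱼ fᵢⱼ = ∑ᵢ aᵢ αᵢ − ∑ⱼ bⱼ βⱼ. -/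
open Filter Topology in
/-- First-order conditions at a minimiser `x < M` of a quadratic function on `[0, M]`, with the
minimality stated through the increment `t * q + K * t ^ 2`. -/
theorem first_order_of_quadratic_nonneg {x M q K : ℝ} (hxM : x < M) (hx : 0 ≤ x)
    (h : ∀ t, -x ≤ t → t ≤ M - x → 0 ≤ t * q + K * t ^ 2) : 0 ≤ q ∧ (0 < x → q = 0) := by
  have lim : Tendsto (fun t : ℝ => q + K * t) (𝓝 0) (𝓝 q) := by
    have : Continuous fun t : ℝ => q + K * t := by fun_prop
    simpa using this.tendsto 0
  have hq : 0 ≤ q := by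
    refine ge_of_tendsto (lim.mono_left (nhdsWithin_le_nhds (s := Set.Ioi 0))) ?_
    filter_upwards [Ioo_mem_nhdsGT (sub_pos.2 hxM)] with t ht
    have := h t (by linarith [ht.1]) ht.2.le
    exact nonneg_of_mul_nonneg_right (by linarith : 0 ≤ t * (q + K * t)) ht.1
  refine ⟨hq, fun hx0 => le_antisymm ?_ hq⟩
  refine le_of_tendsto (lim.mono_left (nhdsWithin_le_nhds (s := Set.Iio 0))) ?_
  filter_upwards [Ioo_mem_nhdsLT (neg_lt_zero.2 hx0)] with t ht
  have := h t ht.1.le (by linarith [ht.2])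
  by_contra! hc
  nlinarith [mul_neg_of_neg_of_pos ht.2 hc]

theorem sum_add_single_sq {ι : Type*} [Fintype ι] [DecidableEq ι] (u : ι → ℝ) (i : ι) (t : ℝ) :
    ∑ x, (u x + (Pi.single i t : ι → ℝ) x) ^ 2 = ∑ x, u x ^ 2 + 2 * t * u i + t ^ 2 := by
  have (x : ι) : (u x + (Pi.single i t : ι → ℝ) x) ^ 2
      = u x ^ 2 + (Pi.single i (2 * t * u i + t ^ 2) : ι → ℝ) x := by
    by_cases h : x = i
    · subst h; simp; ring
    · simp [h]
  simp only [this, Finset.sum_add_distrib, Finset.sum_pi_single', Finset.mem_univ, if_true]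
  ring

namespace Transportation

variable {ι κ : Type*} [Fintype ι] [Fintype κ]

/-- The squared violation of the marginal constraints. -/
def violation (a : ι → ℝ) (b : κ → ℝ) (f : ι → κ → ℝ) : ℝ :=
  ∑ i, (∑ j, f i j - a i) ^ 2 + ∑ j, (∑ i, f i j - b j) ^ 2

/-- The total value of the transport plan `f` for the cost matrix `c`. -/
def profit (c f : ι → κ → ℝ) : ℝ := ∑ i, ∑ j, c i j * f i j

theorem continuous_violation (a : ι → ℝ) (b : κ → ℝ) : Continuous (violation a b) := by
  unfold violation; fun_prop

theorem continuous_profit (c : ι → κ → ℝ) : Continuous (profit c) := by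
  unfold profit; fun_prop

theorem violation_eq_zero_iff {a : ι → ℝ} {b : κ → ℝ} {f : ι → κ → ℝ} :
    violation a b f = 0 ↔ (∀ i, ∑ j, f i j = a i) ∧ ∀ j, ∑ i, f i j = b j := by
  unfold violation
  rw [add_eq_zero_iff_of_nonneg (by positivity) (by positivity),
    Finset.sum_eq_zero_iff_of_nonneg (fun _ _ => sq_nonneg _),
    Finset.sum_eq_zero_iff_of_nonneg (fun _ _ => sq_nonneg _)]
  simp [sub_eq_zero]

theorem violation_nonneg (a : ι → ℝ) (b : κ → ℝ) (f : ι → κ → ℝ) : 0 ≤ violation a b f := by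
  unfold violation; positivity

theorem le_total {a : ι → ℝ} {f : ι → κ → ℝ} (hf : ∀ i j, 0 ≤ f i j)
    (hr : ∀ i, ∑ j, f i j = a i) (i : ι) (j : κ) : f i j ≤ ∑ i, a i := by
  calc f i j ≤ ∑ j, f i j := Finset.single_le_sum (fun j _ => hf i j) (Finset.mem_univ j)
    _ = a i := hr i
    _ ≤ ∑ i, a i := Finset.single_le_sum
      (fun i _ => hr i ▸ Finset.sum_nonneg fun j _ => hf i j) (Finset.mem_univ i)

theorem exists_feasible {a : ι → ℝ} {b : κ → ℝ} (ha : ∀ i, 0 ≤ a i) (hb : ∀ j, 0 ≤ b j)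
    (hab : ∑ i, a i = ∑ j, b j) :
    ∃ f : ι → κ → ℝ, (∀ i j, 0 ≤ f i j) ∧ (∀ i, ∑ j, f i j = a i) ∧ ∀ j, ∑ i, f i j = b j := by
  have hA : 0 ≤ ∑ i, a i := Finset.sum_nonneg fun i _ => ha i
  refine ⟨fun i j => a i * b j / ∑ i, a i,
    fun i j => div_nonneg (mul_nonneg (ha i) (hb j)) hA, fun i => ?_, fun j => ?_⟩
  · rw [← Finset.sum_div, ← Finset.mul_sum, ← hab]
    refine mul_div_cancel_of_imp fun h => ?_
    exact (Finset.sum_eq_zero_iff_of_nonneg fun i _ => ha i).1 h i (Finset.mem_univ i)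
  · rw [← Finset.sum_div, ← Finset.sum_mul, mul_comm]
    refine mul_div_cancel_of_imp fun h => ?_
    exact (Finset.sum_eq_zero_iff_of_nonneg fun j _ => hb j).1 (hab ▸ h) j (Finset.mem_univ j)

section Perturbation

variable [DecidableEq ι] [DecidableEq κ]

theorem violation_add_single (a : ι → ℝ) (b : κ → ℝ) (f : ι → κ → ℝ) (i : ι) (j : κ) (t : ℝ) :
    violation a b (f + Pi.single i (Pi.single j t)) = violation a b f
      + 2 * t * ((∑ j, f i j - a i) + (∑ i, f i j - b j)) + 2 * t ^ 2 := by
  have row (x : ι) : ∑ y, (f + Pi.single i (Pi.single j t) : ι → κ → ℝ) x y - a x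
      = (∑ y, f x y - a x) + (Pi.single i t : ι → ℝ) x := by
    by_cases h : x = i
    · subst h; simp [Finset.sum_add_distrib]; ring
    · simp [h]
  have col (y : κ) : ∑ x, (f + Pi.single i (Pi.single j t) : ι → κ → ℝ) x y - b y
      = (∑ x, f x y - b y) + (Pi.single j t : κ → ℝ) y := by
    have (x : ι) : (Pi.single i (Pi.single j t) : ι → κ → ℝ) x y
        = (Pi.single i ((Pi.single j t : κ → ℝ) y) : ι → ℝ) x := by
      by_cases h : x = i
      · subst h; simp
      · simp [h]
    simp only [Pi.add_apply, this, Finset.sum_add_distrib, Finset.sum_pi_single',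
      Finset.mem_univ, if_true]
    ring
  simp only [violation, row, col, sum_add_single_sq]
  ring

theorem profit_add_single (c f : ι → κ → ℝ) (i : ι) (j : κ) (t : ℝ) :
    profit c (f + Pi.single i (Pi.single j t)) = profit c f + t * c i j := by
  have (x : ι) : ∑ y, c x y * (f + Pi.single i (Pi.single j t) : ι → κ → ℝ) x y
      = ∑ y, c x y * f x y + (Pi.single i (t * c i j) : ι → ℝ) x := by
    by_cases h : x = i
    · subst h; simp [mul_add, Finset.sum_add_distrib, Pi.single_apply, mul_comm]
    · simp [h]
  simp only [profit, this, Finset.sum_add_distrib, Finset.sum_pi_single', Finset.mem_univ,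
    if_true]

end Perturbation

/-- The scaled marginal violations of a minimiser of the penalised problem are dual multipliers. -/
theorem multipliers_of_isMinOn {a : ι → ℝ} {b : κ → ℝ} {c f : ι → κ → ℝ} {K M : ℝ}
    (hf : f ∈ Set.Icc 0 (fun _ _ => M))
    (hmin : IsMinOn (fun g => K * violation a b g - profit c g) (Set.Icc 0 (fun _ _ => M)) f)
    (i : ι) (j : κ) (hM : f i j < M) :
    0 ≤ 2 * K * (∑ j, f i j - a i) - -(2 * K * (∑ i, f i j - b j)) - c i j ∧
    (0 < f i j →
      2 * K * (∑ j, f i j - a i) - -(2 * K * (∑ i, f i j - b j)) - c i j = 0) := by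
  classical
  refine first_order_of_quadratic_nonneg (K := 2 * K) hM (hf.1 i j) fun t ht ht' => ?_
  have hmem : f + Pi.single i (Pi.single j t) ∈ Set.Icc (0 : ι → κ → ℝ) (fun _ _ => M) := by
    have (x : ι) (y : κ) : 0 ≤ (f + Pi.single i (Pi.single j t) : ι → κ → ℝ) x y ∧
        (f + Pi.single i (Pi.single j t) : ι → κ → ℝ) x y ≤ M := by
      by_cases hx : x = i
      · subst hx
        by_cases hy : y = j
        · subst hy
          simp only [Pi.add_apply, Pi.single_eq_same]
          constructor <;> linarith
        · simpa [hy] using And.intro (hf.1 x y) (hf.2 x y)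
      · simpa [hx] using And.intro (hf.1 x y) (hf.2 x y)
    exact ⟨fun x y => (this x y).1, fun x y => (this x y).2⟩
  have h := isMinOn_iff.1 hmin _ hmem
  simp only [violation_add_single, profit_add_single] at h
  linarith

theorem profit_dual_eq {a : ι → ℝ} {b : κ → ℝ} {f : ι → κ → ℝ} (hr : ∀ i, ∑ j, f i j = a i)
    (hc : ∀ j, ∑ i, f i j = b j) (α : ι → ℝ) (β : κ → ℝ) :
    profit (fun i j => α i - β j) f = ∑ i, a i * α i - ∑ j, b j * β j := by
  simp only [profit, sub_mul, Finset.sum_sub_distrib, ← Finset.mul_sum, hr]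
  rw [Finset.sum_comm]
  simp only [hc, mul_comm (β _), mul_comm (α _), ← Finset.sum_mul]

open Filter Topology in
/-- Limits of minimisers of the penalised problems are feasible, and eventually share their support
with the minimisers, so that the multipliers of a late minimiser serve for the limit. -/
theorem exists_complementary {a : ι → ℝ} {b : κ → ℝ} (ha : ∀ i, 0 ≤ a i) (hb : ∀ j, 0 ≤ b j)
    (hab : ∑ i, a i = ∑ j, b j) (c : ι → κ → ℝ) :
    ∃ (f : ι → κ → ℝ) (α : ι → ℝ) (β : κ → ℝ),
      (∀ i j, 0 ≤ f i j) ∧ (∀ i, ∑ j, f i j = a i) ∧ (∀ j, ∑ i, f i j = b j) ∧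
      (∀ i j, c i j ≤ α i - β j) ∧ ∀ i j, f i j * (α i - β j - c i j) = 0 := by
  obtain ⟨f₀, hf₀, hr₀, hc₀⟩ := exists_feasible ha hb hab
  set M := ∑ i, a i + 1 with hM
  set S : Set (ι → κ → ℝ) := Set.Icc 0 (fun _ _ => M) with hS
  have hSc : IsCompact S := isCompact_Icc
  have hf₀S : f₀ ∈ S :=
    ⟨hf₀, fun i j => (le_total hf₀ hr₀ i j).trans (by linarith)⟩
  have hex (k : ℕ) : ∃ g ∈ S, IsMinOn (fun g => (k : ℝ) * violation a b g - profit c g) S g :=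
    hSc.exists_isMinOn ⟨f₀, hf₀S⟩
      (((continuous_violation a b).const_mul _).sub (continuous_profit c)).continuousOn
  choose g hgS hgmin using hex
  obtain ⟨f, hfS, φ, hφ, hlim⟩ := hSc.tendsto_subseq hgS
  have hφtop : Tendsto (fun k => (φ k : ℝ)) atTop atTop :=
    tendsto_natCast_atTop_atTop.comp hφ.tendsto_atTop
  have hviol : violation a b f ≤ 0 := by
    have h1 := ((continuous_violation a b).tendsto f).comp hlim
    have h2 := ((((continuous_profit c).tendsto f).comp hlim).sub_const (profit c f₀)).div_atTop
      hφtop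
    refine le_of_tendsto_of_tendsto h1 h2 ?_
    filter_upwards [hφtop.eventually_gt_atTop 0] with k hk
    have h := isMinOn_iff.1 (hgmin (φ k)) f₀ hf₀S
    simp only [violation_eq_zero_iff.2 ⟨hr₀, hc₀⟩] at h
    simp only [Function.comp_apply]
    rw [le_div_iff₀ hk]
    linarith
  obtain ⟨hr, hc⟩ := violation_eq_zero_iff.1 (hviol.antisymm (violation_nonneg a b f))
  have hcoord (i : ι) (j : κ) : Tendsto (fun k => g (φ k) i j) atTop (𝓝 (f i j)) :=
    (tendsto_pi_nhds.1 (tendsto_pi_nhds.1 hlim i)) j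
  have hev : ∀ᶠ k in atTop, ∀ i j, g (φ k) i j < M ∧ (0 < f i j → 0 < g (φ k) i j) := by
    refine eventually_all.2 fun i => eventually_all.2 fun j => ?_
    have hlt : f i j < M := (le_total hfS.1 hr i j).trans_lt (by linarith)
    refine ((hcoord i j).eventually_lt_const hlt).and ?_
    by_cases hpos : 0 < f i j
    · filter_upwards [(hcoord i j).eventually_const_lt hpos] with k hk _ using hk
    · exact Eventually.of_forall fun _ h => absurd h hpos
  obtain ⟨k, hk⟩ := hev.exists
  have hmult (i : ι) (j : κ) := multipliers_of_isMinOn (hgS (φ k)) (hgmin (φ k)) i j (hk i j).1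
  refine ⟨f, fun i => 2 * (φ k : ℝ) * (∑ j, g (φ k) i j - a i),
    fun j => -(2 * (φ k : ℝ) * (∑ i, g (φ k) i j - b j)), hfS.1, hr, hc,
    fun i j => sub_nonneg.1 (hmult i j).1, fun i j => ?_⟩
  rcases (hfS.1 i j).eq_or_lt with h | h
  · exact mul_eq_zero_of_left h.symm _
  · exact mul_eq_zero_of_right _ ((hmult i j).2 ((hk i j).2 h))

end Transportation


/-- Correctness of the algorithm / strong duality: there exist a feasible
solution `f` and dual variables `α`, `β` which are dual feasible and satisfy
complementary slackness; consequently `f` is optimal and its cost equals the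
dual objective. -/
theorem transportation_strong_duality
    (m n : ℕ) (hm : 0 < m) (hn : 0 < n)
    (a : Fin m → ℝ) (b : Fin n → ℝ)
    (ha : ∀ i, 0 ≤ a i) (hb : ∀ j, 0 ≤ b j)
    (hab : ∑ i, a i = ∑ j, b j)
    (c : Fin m → Fin n → ℝ) :
    ∃ (f : Fin m → Fin n → ℝ) (α : Fin m → ℝ) (β : Fin n → ℝ),
      (∀ i j, 0 ≤ f i j) ∧
      (∀ i, ∑ j, f i j = a i) ∧
      (∀ j, ∑ i, f i j = b j) ∧
      (∀ i j, α i - β j ≥ c i j) ∧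
      (∀ i j, f i j * (α i - β j - c i j) = 0) ∧
      (∀ f' : Fin m → Fin n → ℝ,
        (∀ i j, 0 ≤ f' i j) → (∀ i, ∑ j, f' i j = a i) → (∀ j, ∑ i, f' i j = b j) →
        ∑ i, ∑ j, c i j * f' i j ≤ ∑ i, ∑ j, c i j * f i j) ∧
      ∑ i, ∑ j, c i j * f i j = ∑ i, a i * α i - ∑ j, b j * β j := by
  obtain ⟨f, α, β, hf, hr, hc, hdual, hslack⟩ := Transportation.exists_complementary ha hb hab c
  have hval : ∑ i, ∑ j, c i j * f i j = ∑ i, a i * α i - ∑ j, b j * β j := by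
    rw [← Transportation.profit_dual_eq hr hc α β]
    refine Finset.sum_congr rfl fun i _ => Finset.sum_congr rfl fun j _ => ?_
    linarith [hslack i j]
  refine ⟨f, α, β, hf, hr, hc, hdual, hslack, fun f' hf' hr' hc' => ?_, hval⟩
  rw [hval, ← Transportation.profit_dual_eq hr' hc' α β]
  exact Finset.sum_le_sum fun i _ => Finset.sum_le_sum fun j _ =>
    mul_le_mul_of_nonneg_right (hdual i j) (hf' i j)
end

section
/- (Integrality for the assignment problem on forest supports.) Let n be a positive integer and let f : Fin n → Fin n → ℝ be a feasible solution of the assignment problem, i.e., fᵢⱼ ≥ 0, ∑ⱼ fᵢⱼ = 1 for every i, and ∑ᵢ fᵢⱼ = 1 for every j. Suppose the support of f is acyclic: there is no cyclic sequence of distinct rows i₁, …, i_p and distinct columns j₁, …, j_p with p ≥ 2 such that f_{i_k j_k} > 0 for k = 1, …, p and f_{i_{k+1} j_k} > 0 for k = 1, …, p (indices cyclic, i_{p+1} = i₁). Then fᵢⱼ ∈ {0, 1} for all i, j, so f is a solution of the assignment problem with the 0–1 constraint. -/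
/-- If one entry of a nonnegative family summing to `1` lies strictly between `0` and `1`, then so
does a second entry. -/
theorem exists_ne_fractional_of_sum_eq_one {ι : Type*} [Fintype ι] [DecidableEq ι] {g : ι → ℝ}
    (hg : ∀ i, 0 ≤ g i) (hsum : ∑ i, g i = 1) {a : ι} (ha₀ : 0 < g a) (ha₁ : g a < 1) :
    ∃ b, b ≠ a ∧ 0 < g b ∧ g b < 1 := by
  have hsplit := Finset.add_sum_erase Finset.univ g (Finset.mem_univ a)
  obtain ⟨b, hb, hpos⟩ : ∃ b ∈ Finset.univ.erase a, 0 < g b := by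
    by_contra! h
    have := Finset.sum_nonpos h
    linarith
  have hle := Finset.single_le_sum (fun i _ => hg i) hb
  exact ⟨b, Finset.ne_of_mem_erase hb, hpos, by linarith⟩

/-- An infinite non-backtracking alternating walk `I 0, J 0, I 1, J 1, …` in a bipartite graph with
finitely many vertices on one side contains a cycle. -/
theorem exists_cycle_of_alternating_walk {α β : Type*} [Finite α] {R : α → β → Prop}
    {I : ℕ → α} {J : ℕ → β} (hR : ∀ k, R (I k) (J k)) (hR' : ∀ k, R (I (k + 1)) (J k))
    (hI : ∀ k, I (k + 1) ≠ I k) (hJ : ∀ k, J (k + 1) ≠ J k) :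
    ∃ p : ℕ, 2 ≤ p ∧ ∃ (I' : ZMod p → α) (J' : ZMod p → β),
      Function.Injective I' ∧ Function.Injective J' ∧
      ∀ k : ZMod p, R (I' k) (J' k) ∧ R (I' (k + 1)) (J' k) := by
  classical
  have hex : ∃ p, 0 < p ∧ ∃ a, I (a + p) = I a ∨ J (a + p) = J a := by
    obtain ⟨x, y, hne, hxy⟩ := Finite.exists_ne_map_eq_of_infinite I
    rcases lt_or_gt_of_ne hne with h | h
    · exact ⟨y - x, by omega, x, Or.inl (by rw [Nat.add_sub_cancel' h.le, hxy])⟩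
    · exact ⟨x - y, by omega, y, Or.inl (by rw [Nat.add_sub_cancel' h.le, hxy])⟩
  obtain ⟨hp₀, a, ha⟩ := Nat.find_spec hex
  have hmin := fun q => Nat.find_min (m := q) hex
  generalize Nat.find hex = p at hp₀ ha hmin
  have hp : 2 ≤ p := by
    by_contra! h
    obtain rfl : p = 1 := by omega
    exact ha.elim (hI a) (hJ a)
  have : NeZero p := ⟨hp₀.ne'⟩
  obtain ⟨s, hs⟩ : ∃ s, R (I s) (J (s + (p - 1))) := by
    rcases ha with h | h
    · refine ⟨a, ?_⟩
      have := hR' (a + (p - 1))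
      rwa [show a + (p - 1) + 1 = a + p by omega, h] at this
    · refine ⟨a + 1, ?_⟩
      rw [show a + 1 + (p - 1) = a + p by omega, h]
      exact hR' a
  have hdistinct : ∀ u v : ℕ, u < v → v < p → I (s + v) ≠ I (s + u) ∧ J (s + v) ≠ J (s + u) := by
    intro u v huv hv
    have h := hmin (v - u) (by omega)
    push Not at h
    have := h (by omega) (s + u)
    rwa [show s + u + (v - u) = s + v by omega] at this
  refine ⟨p, hp, fun k => I (s + k.val), fun k => J (s + k.val), ?_, ?_, fun k => ⟨hR _, ?_⟩⟩
  · intro x y hxy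
    by_contra hne
    rcases lt_or_gt_of_ne (mt (ZMod.val_injective p (a₁ := x) (a₂ := y)) hne) with h | h
    · exact (hdistinct _ _ h y.val_lt).1 hxy.symm
    · exact (hdistinct _ _ h x.val_lt).1 hxy
  · intro x y hxy
    by_contra hne
    rcases lt_or_gt_of_ne (mt (ZMod.val_injective p (a₁ := x) (a₂ := y)) hne) with h | h
    · exact (hdistinct _ _ h y.val_lt).2 hxy.symm
    · exact (hdistinct _ _ h x.val_lt).2 hxy
  · have hval : (k + 1).val = (k.val + 1) % p := by
      rw [ZMod.val_add, ZMod.val_one'' (by omega)]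
    have hk := k.val_lt
    change R (I (s + (k + 1).val)) (J (s + k.val))
    by_cases h : k.val + 1 < p
    · rw [hval, Nat.mod_eq_of_lt h]
      exact hR' _
    · rw [hval, show k.val + 1 = p by omega, Nat.mod_self, show k.val = p - 1 by omega]
      exact hs

/-- Integrality for the assignment problem on forest supports: a feasible
solution of the assignment problem whose support (the bipartite graph of pairs
`(i, j)` with `f i j > 0`) contains no cycle takes only the values `0` and
`1`. -/
theorem assignment_forest_support_integral
    (n : ℕ) (hn : 0 < n)
    (f : Fin n → Fin n → ℝ)
    (hf_nonneg : ∀ i j, 0 ≤ f i j)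
    (hf_row : ∀ i, ∑ j, f i j = 1)
    (hf_col : ∀ j, ∑ i, f i j = 1)
    (hacyclic : ¬ ∃ (p : ℕ), 2 ≤ p ∧
      ∃ (I : ZMod p → Fin n) (J : ZMod p → Fin n),
        Function.Injective I ∧ Function.Injective J ∧
        ∀ k : ZMod p, 0 < f (I k) (J k) ∧ 0 < f (I (k + 1)) (J k)) :
    ∀ i j, f i j = 0 ∨ f i j = 1 := by
  intro i j
  by_contra! hij
  have hle : f i j ≤ 1 :=
    (Finset.single_le_sum (fun j _ => hf_nonneg i j) (Finset.mem_univ j)).trans_eq (hf_row i)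
  have hstep : ∀ x : {x : Fin n × Fin n // 0 < f x.1 x.2 ∧ f x.1 x.2 < 1},
      ∃ y : {x : Fin n × Fin n // 0 < f x.1 x.2 ∧ f x.1 x.2 < 1},
        y.1.1 ≠ x.1.1 ∧ y.1.2 ≠ x.1.2 ∧ 0 < f y.1.1 x.1.2 := by
    rintro ⟨⟨a, b⟩, h₀, h₁⟩
    obtain ⟨a', ha', ha₀, ha₁⟩ :=
      exists_ne_fractional_of_sum_eq_one (fun i => hf_nonneg i b) (hf_col b) h₀ h₁
    obtain ⟨b', hb', hb⟩ :=
      exists_ne_fractional_of_sum_eq_one (hf_nonneg a') (hf_row a') ha₀ ha₁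
    exact ⟨⟨(a', b'), hb⟩, ha', hb', ha₀⟩
  choose step hrow hcol hpos using hstep
  let x₀ : {x : Fin n × Fin n // 0 < f x.1 x.2 ∧ f x.1 x.2 < 1} :=
    ⟨(i, j), (hf_nonneg i j).lt_of_ne' hij.1, hle.lt_of_ne hij.2⟩
  refine hacyclic (exists_cycle_of_alternating_walk (R := fun a b => 0 < f a b)
    (I := fun k => (step^[k] x₀).1.1) (J := fun k => (step^[k] x₀).1.2)
    (fun k => (step^[k] x₀).2.1) (fun k => ?_) (fun k => ?_) (fun k => ?_))
  all_goals simp only [Function.iterate_succ_apply']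
  · exact hpos _
  · exact hrow _
  · exact hcol _
end
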